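/- arXiv:2411.05941 — 2 statements merged into one kernel-verified Lean document; each statement's English description precedes it below -/
import Mathlib

section
/- Define γ₄ : ℕ₊ → ℤ by: γ₄(n) = (if n is a perfect square then n else 0) + 2·Σ over pairs of positive integers (n₁,n₂) with n₁²+9n₂² = n of (n₁²−9n₂²), if n ≡ 1 (mod 3); γ₄(n) = −2·Σ over pairs of positive integers (n₁,n₂) with n₁²+n₂² = n of χ_{−3}(n₁)·χ_{−3}(n₂)·n₁·n₂, if n ≡ 2 (mod 3); and γ₄(n) = 0 if 3 ∣ n. Then for every positive integer n, γ₄(n) = 0 if and only if 3 ∣ n or there exists a prime p ≡ 3 (mod 4) such that ord_p(n) is odd. -/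
open Finset

/-- The quadratic character modulo 3. -/
def χ₃ (m : ℕ) : ℤ := if m % 3 = 1 then 1 else if m % 3 = 2 then -1 else 0

/-- The arithmetic function `γ₄` of Fourier coefficients of the newform
`g₄ ∈ S₃(Γ₀(36), χm4)`. -/
noncomputable def gamma4 (n : ℕ) : ℤ :=
  if n % 3 = 1 then
    (if Nat.sqrt n * Nat.sqrt n = n then (n : ℤ) else 0)
      + 2 * ∑ p ∈ (Finset.Icc 1 n ×ˢ Finset.Icc 1 n).filter (fun p => p.1 ^ 2 + 9 * p.2 ^ 2 = n), ((p.1 : ℤ) ^ 2 - 9 * (p.2 : ℤ) ^ 2)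
  else if n % 3 = 2 then
    -2 * ∑ p ∈ (Finset.Icc 1 n ×ˢ Finset.Icc 1 n).filter (fun p => p.1 ^ 2 + p.2 ^ 2 = n), χ₃ p.1 * χ₃ p.2 * p.1 * p.2
  else 0


def e3 (t : ZMod 3) : ℤ := if t = 1 then 1 else if t = 2 then -1 else 0

def c3 (t : ℤ) : ℤ := e3 (t : ZMod 3)

def epsG (a : GaussianInt) : GaussianInt := ⟨c3 (a.re ^ 2 - a.im ^ 2), c3 (a.re * a.im)⟩

def psiG (a : GaussianInt) : GaussianInt := epsG a * a ^ 2

lemma epsG_mul (a b : GaussianInt) : epsG (a * b) = epsG a * epsG b := by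
  obtain ⟨x, y⟩ := a
  obtain ⟨z, w⟩ := b
  have key : ∀ x y z w : ZMod 3,
      e3 ((x * z + -1 * y * w) ^ 2 - (x * w + y * z) ^ 2) =
        e3 (x ^ 2 - y ^ 2) * e3 (z ^ 2 - w ^ 2) + -1 * e3 (x * y) * e3 (z * w) ∧
      e3 ((x * z + -1 * y * w) * (x * w + y * z)) =
        e3 (x ^ 2 - y ^ 2) * e3 (z * w) + e3 (x * y) * e3 (z ^ 2 - w ^ 2) := by decide
  have := key x y z w
  simp only [epsG, c3, Zsqrtd.ext_iff, Zsqrtd.re_mul, Zsqrtd.im_mul]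
  push_cast
  exact this

lemma psiG_mul (a b : GaussianInt) : psiG (a * b) = psiG a * psiG b := by
  simp only [psiG, epsG_mul]; ring

lemma psiG_one : psiG 1 = 1 := by decide

lemma psiG_pow (a : GaussianInt) (k : ℕ) : psiG (a ^ k) = psiG a ^ k := by
  induction k with
  | zero => simpa using psiG_one
  | succ k ih => rw [pow_succ, psiG_mul, ih, pow_succ]

lemma c3_neg (t : ℤ) : c3 (-t) = - c3 t := by
  have key : ∀ t : ZMod 3, e3 (-t) = - e3 t := by decide
  have := key t
  unfold c3; push_cast; exact this

lemma epsG_star (a : GaussianInt) : epsG (star a) = star (epsG a) := by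
  simp [epsG, Zsqrtd.ext_iff, c3_neg]

lemma psiG_star (a : GaussianInt) : psiG (star a) = star (psiG a) := by
  simp [psiG, epsG_star, mul_comm]

lemma epsG_norm (a : GaussianInt) (h : ¬ (3:ℤ) ∣ a.norm) : (epsG a).norm = 1 := by
  obtain ⟨x, y⟩ := a
  have key : ∀ x y : ZMod 3, x * x - -1 * y * y ≠ 0 →
      e3 (x ^ 2 - y ^ 2) * e3 (x ^ 2 - y ^ 2) - -1 * e3 (x * y) * e3 (x * y) = 1 := by decide
  have h' : (((x * x - -1 * y * y : ℤ)) : ZMod 3) ≠ 0 := by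
    intro hc
    exact h ((ZMod.intCast_zmod_eq_zero_iff_dvd _ 3).1 hc)
  push_cast at h'
  have := key x y h'
  simp only [epsG, c3, Zsqrtd.norm]
  push_cast
  exact this

lemma psiG_ne_zero (a : GaussianInt) (h : ¬ (3:ℤ) ∣ a.norm) : psiG a ≠ 0 := by
  have h1 := epsG_norm a h
  unfold psiG
  apply mul_ne_zero
  · intro h0; rw [h0] at h1; simp at h1
  · apply pow_ne_zero
    rintro rfl
    simp at h

noncomputable def boxZ (n : ℕ) : Finset ℤ := Finset.Icc (-(n:ℤ)) n

noncomputable def SG (n : ℕ) : Finset GaussianInt :=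
  ((boxZ n ×ˢ boxZ n).filter (fun p => p.1 ^ 2 + p.2 ^ 2 = (n:ℤ))).map
    ⟨fun p => ⟨p.1, p.2⟩, fun p q h => by simpa [Zsqrtd.ext_iff, Prod.ext_iff] using h⟩

lemma norm_def' (a : GaussianInt) : a.norm = a.re ^ 2 + a.im ^ 2 := by
  simp [Zsqrtd.norm]; ring

lemma mem_SG (n : ℕ) (a : GaussianInt) : a ∈ SG n ↔ a.norm = n := by
  rw [norm_def']
  simp only [SG, boxZ, mem_map, mem_filter, mem_product, mem_Icc, Function.Embedding.coeFn_mk, Prod.exists]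
  constructor
  · rintro ⟨x, y, ⟨-, h⟩, rfl⟩; exact h
  · intro h
    refine ⟨a.re, a.im, ⟨⟨⟨?_, ?_⟩, ?_, ?_⟩, h⟩, rfl⟩ <;> nlinarith [sq_nonneg (a.re - 1), sq_nonneg (a.im - 1), sq_nonneg (a.re + 1), sq_nonneg (a.im + 1), sq_nonneg a.re, sq_nonneg a.im, Int.le_self_sq a.re, Int.le_self_sq a.im, Int.le_self_sq (-a.re), Int.le_self_sq (-a.im)]

noncomputable def AG (n : ℕ) : GaussianInt := ∑ a ∈ SG n, psiG a

open Classical in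
lemma sum_dvd (d : GaussianInt) (hd : d ≠ 0) (n m : ℕ) (hm : (m:ℤ) = d.norm * n) :
    ∑ a ∈ (SG m).filter (fun a => d ∣ a), psiG a = psiG d * AG n := by
  rw [AG, Finset.mul_sum]
  symm
  have hdn : d.norm ≠ 0 := by
    intro h; exact hd ((GaussianInt.norm_eq_zero).1 h)
  refine Finset.sum_bij (fun a _ => d * a) ?_ ?_ ?_ ?_
  · intro a ha
    rw [mem_SG] at ha
    rw [mem_filter, mem_SG, Zsqrtd.norm_mul, ha, hm]
    exact ⟨rfl, dvd_mul_right _ _⟩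
  · intro a _ b _ h; exact mul_left_cancel₀ hd h
  · intro b hb
    rw [mem_filter, mem_SG] at hb
    obtain ⟨hb, a, rfl⟩ := hb
    refine ⟨a, ?_, rfl⟩
    rw [mem_SG]
    rw [Zsqrtd.norm_mul, hm] at hb
    exact mul_left_cancel₀ hdn hb
  · intro a _; rw [psiG_mul]

lemma AG_all (d : GaussianInt) (hd : d ≠ 0) (n m : ℕ) (hm : (m:ℤ) = d.norm * n)
    (h : ∀ a : GaussianInt, a.norm = m → d ∣ a) : AG m = psiG d * AG n := by
  classical
  rw [← sum_dvd d hd n m hm, AG, Finset.filter_true_of_mem]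
  intro a ha; exact h a ((mem_SG _ _).1 ha)

lemma AG_two (n : ℕ) : AG (2 * n) = psiG ⟨1, 1⟩ * AG n := by
  apply AG_all
  · decide
  · simp [Zsqrtd.norm]
  · intro a ha
    rw [norm_def'] at ha
    have h2 : (a.re + a.im) % 2 = 0 := by
      have : (a.re + a.im) ^ 2 = 2 * (n + a.re * a.im) := by push_cast at ha; linarith
      have h3 : (2:ℤ) ∣ (a.re + a.im) ^ 2 := ⟨_, this⟩
      have := Int.prime_two.dvd_of_dvd_pow h3
      omega
    refine ⟨⟨(a.re + a.im) / 2, (a.im - a.re) / 2⟩, ?_⟩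
    simp only [Zsqrtd.ext_iff, Zsqrtd.re_mul, Zsqrtd.im_mul]
    constructor <;> omega

lemma AG_inert (q : ℕ) (hq : q.Prime) (hq3 : q % 4 = 3) (n : ℕ) :
    AG (q ^ 2 * n) = psiG (q : GaussianInt) * AG n := by
  have := Fact.mk hq
  have hp := GaussianInt.prime_of_nat_prime_of_mod_four_eq_three q hq3
  apply AG_all
  · exact hp.ne_zero
  · rw [Zsqrtd.norm_natCast]; push_cast; ring
  · intro a ha
    have h : (q : GaussianInt) ∣ a * star a := by
      rw [← Zsqrtd.norm_eq_mul_conj, ha]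
      refine ⟨((q * n : ℕ) : GaussianInt), ?_⟩
      push_cast; ring
    rcases hp.dvd_or_dvd h with h | h
    · exact h
    · obtain ⟨b, hb⟩ := h
      refine ⟨star b, ?_⟩
      rw [← star_star a, hb]; simp [mul_comm]

lemma prime_of_norm (d : GaussianInt) (p : ℕ) (hp : p.Prime) (h : d.norm = p) : Prime d := by
  rw [← irreducible_iff_prime]
  have hn : d.norm.natAbs = p := by rw [h]; simp
  constructor
  · intro hu
    rw [← Zsqrtd.norm_eq_one_iff, hn] at hu
    exact hp.one_lt.ne' hu
  · intro a b hab
    rw [← Zsqrtd.norm_eq_one_iff, ← Zsqrtd.norm_eq_one_iff]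
    rw [hab, Zsqrtd.norm_mul, Int.natAbs_mul] at hn
    have := Nat.prime_mul_iff.1 (hn ▸ hp)
    tauto

lemma norm_star' (a : GaussianInt) : (star a).norm = a.norm := Zsqrtd.norm_conj a

lemma norm_dvd (a b : GaussianInt) (h : a ∣ b) : a.norm ∣ b.norm := by
  obtain ⟨c, rfl⟩ := h
  rw [Zsqrtd.norm_mul]; exact dvd_mul_right _ _

lemma not_dvd_star (d : GaussianInt) (p : ℕ) (hp : p.Prime) (h2 : p ≠ 2) (h : d.norm = p) :
    ¬ d ∣ star d := by
  intro hd
  have h1 : d ∣ ((2 * d.re : ℤ) : GaussianInt) := by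
    have : ((2 * d.re : ℤ) : GaussianInt) = d + star d := by
      simp [Zsqrtd.ext_iff]; ring
    rw [this]; exact dvd_add (dvd_refl _) hd
  have h3 := norm_dvd _ _ h1
  rw [h, Zsqrtd.norm_intCast] at h3
  have hpp := Nat.prime_iff_prime_int.1 hp
  have h4 : (p:ℤ) ∣ d.re := by
    have h5 : (p:ℤ) ∣ 2 * d.re := by rcases hpp.dvd_or_dvd h3 with h | h <;> exact h
    rcases hpp.dvd_or_dvd h5 with h | h
    · exfalso
      have : p ∣ 2 := by exact_mod_cast h
      exact h2 ((Nat.prime_dvd_prime_iff_eq hp Nat.prime_two).1 this)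
    · exact h
  rw [norm_def'] at h
  have h6 : (p:ℤ) ∣ d.im := by
    have : (p:ℤ) ∣ d.im ^ 2 := by
      have : d.im ^ 2 = p - d.re ^ 2 := by linarith
      rw [this]
      exact dvd_sub (dvd_refl _) (dvd_pow h4 two_ne_zero)
    exact hpp.dvd_of_dvd_pow this
  obtain ⟨u, hu⟩ := h4
  obtain ⟨v, hv⟩ := h6
  rw [hu, hv] at h
  have h7 : (p:ℤ) * (p * (u ^ 2 + v ^ 2)) = p * 1 := by linarith
  have h8 := mul_left_cancel₀ hpp.ne_zero h7
  exact hpp.not_isUnit (IsUnit.of_mul_eq_one _ h8)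

lemma AG_split (d : GaussianInt) (p : ℕ) (hp : p.Prime) (h2 : p ≠ 2) (h : d.norm = p)
    (m : ℕ) (hm : ¬ p ∣ m) (k : ℕ) :
    AG (p ^ (k+1) * m) = psiG d * AG (p ^ k * m) + psiG (star d) ^ (k+1) * AG m := by
  classical
  have hd := prime_of_norm d p hp h
  have hs : (star d).norm = p := by rw [norm_star', h]
  have hds := prime_of_norm (star d) p hp hs
  have hnm : ∀ j : ℕ, ((star d) ^ j).norm = (p:ℤ) ^ j := by
    intro j
    have := map_pow (Zsqrtd.normMonoidHom (d := -1)) (star d) j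
    have e : ∀ a, Zsqrtd.normMonoidHom (d := -1) a = a.norm := fun _ => rfl
    rw [e, e, hs] at this
    exact this
  rw [AG, ← Finset.sum_filter_add_sum_filter_not _ (fun a => d ∣ a),
    sum_dvd d hd.ne_zero (p ^ k * m) _ (by rw [h]; push_cast; ring), ← psiG_pow,
    ← sum_dvd ((star d) ^ (k+1)) (pow_ne_zero _ hds.ne_zero) m (p ^ (k+1) * m)
      (by rw [hnm]; push_cast; ring)]
  congr 2
  apply Finset.filter_congr
  intro a ha
  rw [mem_SG] at ha
  constructor
  · intro hna
    have h1 : (star d) ^ (k+1) ∣ a * star a := by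
      rw [← Zsqrtd.norm_eq_mul_conj, ha]
      refine ⟨d ^ (k+1) * (m : GaussianInt), ?_⟩
      have : (p : GaussianInt) = d * star d := by
        rw [← Zsqrtd.norm_eq_mul_conj, h]; simp
      push_cast
      rw [this]; ring
    refine hds.pow_dvd_of_dvd_mul_right _ ?_ h1
    rintro ⟨b, hb⟩
    apply hna
    refine ⟨star b, ?_⟩
    rw [← star_star a, hb]; simp [mul_comm]
  · rintro ⟨b, rfl⟩ hda
    rw [Zsqrtd.norm_mul, hnm] at ha
    push_cast at ha
    have hb : b.norm = m := mul_left_cancel₀ (pow_ne_zero _ (by exact_mod_cast hp.ne_zero)) ha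
    rcases hd.dvd_or_dvd hda with h1 | h1
    · exact not_dvd_star d p hp h2 h (hd.dvd_of_dvd_pow h1)
    · have := norm_dvd _ _ h1
      rw [h, hb] at this
      exact hm (by exact_mod_cast this)

lemma AG_split_ne (p : ℕ) (hp : p.Prime) (h2 : p % 4 = 1) (h3 : p ≠ 3)
    (m : ℕ) (hm : ¬ p ∣ m) (k : ℕ) (hA : AG m ≠ 0) : AG (p ^ k * m) ≠ 0 := by
  have := Fact.mk hp
  obtain ⟨x, y, hxy⟩ := Nat.Prime.sq_add_sq (p := p) (by omega)
  set d : GaussianInt := ⟨x, y⟩ with hdd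
  have h : d.norm = p := by rw [norm_def']; simp [hdd]; exact_mod_cast hxy
  have hp2 : p ≠ 2 := by omega
  have hd := prime_of_norm d p hp h
  have hs : (star d).norm = p := by rw [norm_star', h]
  have hnd : ¬ d ∣ psiG (star d) := by
    intro hc
    rcases hd.dvd_or_dvd hc with h1 | h1
    · have := norm_dvd _ _ h1
      rw [epsG_norm, h] at this
      · have h5 : p ∣ 1 := by exact_mod_cast this
        exact hp.one_lt.ne' (Nat.dvd_one.1 h5)
      · rw [hs]
        intro h4
        have h5 : 3 ∣ p := by exact_mod_cast h4
        exact h3 ((Nat.prime_dvd_prime_iff_eq Nat.prime_three hp).1 h5).symm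
    · exact not_dvd_star d p hp hp2 h (hd.dvd_of_dvd_pow h1)
  have key : ∀ k : ℕ, ∃ B : GaussianInt, ¬ d ∣ B ∧ AG (p ^ k * m) = B * AG m := by
    intro k
    induction k with
    | zero => exact ⟨1, hd.not_dvd_one, by simp⟩
    | succ k ih =>
      obtain ⟨B, -, hB⟩ := ih
      refine ⟨psiG d * B + psiG (star d) ^ (k+1), ?_, ?_⟩
      · intro hc
        have h1 : d ∣ psiG d * B := by
          unfold psiG
          exact Dvd.dvd.mul_right (Dvd.dvd.mul_left (dvd_pow_self _ two_ne_zero) _) _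
        exact hnd (hd.dvd_of_dvd_pow ((dvd_add_right h1).1 hc))
      · rw [AG_split d p hp hp2 h m hm, hB]; ring
  obtain ⟨B, hB, hE⟩ := key k
  rw [hE]
  refine mul_ne_zero ?_ hA
  rintro rfl
  exact hB (dvd_zero _)

lemma AG_one : AG 1 ≠ 0 := by
  have : SG 1 = {⟨1,0⟩, ⟨-1,0⟩, ⟨0,1⟩, ⟨0,-1⟩} := by decide
  rw [AG, this]
  decide

lemma AG_ne_zero (n : ℕ) : 0 < n → ¬ 3 ∣ n →
    (∀ p : ℕ, p.Prime → p % 4 = 3 → Even (padicValNat p n)) → AG n ≠ 0 := by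
  induction n using Nat.strong_induction_on with
  | _ n ih =>
  intro hn h3 hq
  by_cases h1 : n = 1
  · subst h1; exact AG_one
  obtain ⟨p, hp, hpn⟩ := Nat.exists_prime_and_dvd h1
  have := Fact.mk hp
  have hp3 : p ≠ 3 := by rintro rfl; exact h3 hpn
  have hcases : p = 2 ∨ p % 4 = 3 ∨ p % 4 = 1 := by
    rcases hp.eq_two_or_odd with h | h <;> omega
  rcases hcases with rfl | h | h
  · obtain ⟨m, rfl⟩ := hpn
    rw [AG_two]
    refine mul_ne_zero (by decide) (ih m (by omega) (by omega) (by omega) ?_)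
    intro q hqp hq4
    have := Fact.mk hqp
    have := hq q hqp hq4
    rwa [padicValNat.mul (by omega) (by omega),
      padicValNat_primes (by omega : q ≠ 2), zero_add] at this
  · have he := hq p hp h
    have h0 : padicValNat p n ≠ 0 := (dvd_iff_padicValNat_ne_zero hn.ne').1 hpn
    have h2 : p ^ 2 ∣ n := by
      rw [padicValNat_dvd_iff_le hn.ne']
      obtain ⟨r, hr⟩ := he
      omega
    obtain ⟨m, rfl⟩ := h2
    have hm0 : 0 < m := Nat.pos_of_ne_zero (by rintro rfl; simp at hn)
    have hp1 := hp.one_lt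
    rw [AG_inert p hp h]
    refine mul_ne_zero (psiG_ne_zero _ ?_) (ih m (by nlinarith [Nat.one_lt_pow two_ne_zero hp1]) hm0
      (fun hc => h3 (hc.mul_left _)) ?_)
    · rw [Zsqrtd.norm_natCast]
      intro hc
      have h5 : 3 ∣ p * p := by exact_mod_cast hc
      have h6 : 3 ∣ p := by rcases (Nat.prime_three.dvd_mul).1 h5 with h | h <;> exact h
      exact hp3 ((Nat.prime_dvd_prime_iff_eq Nat.prime_three hp).1 h6).symm
    · intro q hqp hq4
      have := Fact.mk hqp
      have := hq q hqp hq4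
      rw [padicValNat.mul (pow_ne_zero _ hp.ne_zero) hm0.ne', padicValNat.pow] at this
      rw [Nat.even_add] at this
      exact this.1 (even_two_mul _)
  · obtain ⟨k, m, hpm, hkm⟩ := Nat.exists_eq_pow_mul_and_not_dvd hn.ne' p hp.ne_one
    have hk : k ≠ 0 := by
      rintro rfl
      apply hpm; simpa [hkm] using hpn
    subst hkm
    have hm0 : 0 < m := Nat.pos_of_ne_zero (by rintro rfl; simp at hn)
    refine AG_split_ne p hp h hp3 m hpm k (ih m ?_ hm0 (fun hc => h3 (hc.mul_left _)) ?_)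
    · have : 1 < p ^ k := Nat.one_lt_pow hk hp.one_lt
      nlinarith
    · intro q hqp hq4
      have := Fact.mk hqp
      have := hq q hqp hq4
      rwa [padicValNat.mul (pow_ne_zero _ hp.ne_zero) hm0.ne', padicValNat.pow,
        padicValNat_primes (by rintro rfl; omega : q ≠ p), mul_zero, zero_add] at this

lemma AG_im (n : ℕ) : (AG n).im = 0 := by
  have h : star (AG n) = AG n := by
    rw [AG, star_sum]
    refine Finset.sum_bij (fun a _ => star a) ?_ ?_ ?_ ?_
    · intro a ha; rw [mem_SG] at ha ⊢; rw [norm_star', ha]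
    · intro a _ b _ h; exact star_injective h
    · intro b hb
      refine ⟨star b, ?_, star_star b⟩
      rw [mem_SG] at hb ⊢; rw [norm_star', hb]
    · intro a _; rw [psiG_star]
  have := congrArg Zsqrtd.im h
  simp at this
  omega

def fR (x y : ℤ) : ℤ := c3 (x ^ 2 - y ^ 2) * (x ^ 2 - y ^ 2) - 2 * (c3 (x * y) * (x * y))

lemma AG_re (n : ℕ) : (AG n).re =
    ∑ x ∈ boxZ n, ∑ y ∈ boxZ n, if x ^ 2 + y ^ 2 = (n:ℤ) then fR x y else 0 := by
  have h : ∀ s : Finset GaussianInt, (∑ a ∈ s, psiG a).re = ∑ a ∈ s, (psiG a).re := by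
    intro s
    exact map_sum (⟨⟨Zsqrtd.re, rfl⟩, fun _ _ => rfl⟩ : GaussianInt →+ ℤ) _ _
  rw [AG, h, SG, Finset.sum_map, Finset.sum_filter, Finset.sum_product]
  refine Finset.sum_congr rfl fun x _ => Finset.sum_congr rfl fun y _ => ?_
  congr 1
  change (psiG ⟨x, y⟩).re = fR x y
  simp [psiG, epsG, fR, pow_two]
  ring

lemma sum_even (f : ℤ → ℤ) (hf : ∀ x, f (-x) = f x) (N : ℕ) :
    ∑ x ∈ boxZ N, f x = f 0 + 2 * ∑ x ∈ Finset.Icc 1 N, f (x : ℤ) := by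
  induction N with
  | zero => simp [boxZ]
  | succ N ih =>
    have : boxZ (N+1) = insert (-((N:ℤ)+1)) (insert ((N:ℤ)+1) (boxZ N)) := by
      ext x; simp only [boxZ, Finset.mem_insert, Finset.mem_Icc]; push_cast; omega
    rw [this, Finset.sum_insert, Finset.sum_insert, ih, Finset.sum_Icc_succ_top (by omega), hf]
    · push_cast; ring
    · simp [boxZ]
    · simp only [boxZ, Finset.mem_insert, Finset.mem_Icc]; omega

lemma c3_nat (x : ℕ) : c3 (x : ℤ) = χ₃ x := by
  have h : ((x : ℤ) : ZMod 3) = ((x % 3 : ℕ) : ZMod 3) := by simp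
  unfold c3 χ₃
  rw [h]
  have : x % 3 = 0 ∨ x % 3 = 1 ∨ x % 3 = 2 := by omega
  rcases this with h | h | h <;> rw [h] <;> decide

lemma c3_mul (x y : ℤ) : c3 (x * y) = c3 x * c3 y := by
  have key : ∀ x y : ZMod 3, e3 (x * y) = e3 x * e3 y := by decide
  unfold c3; push_cast; exact key _ _

lemma sum_even2 (f : ℤ → ℤ → ℤ) (h1 : ∀ x y, f (-x) y = f x y) (h2 : ∀ x y, f x (-y) = f x y)
    (N : ℕ) : ∑ x ∈ boxZ N, ∑ y ∈ boxZ N, f x y = f 0 0 + 2 * ∑ y ∈ Finset.Icc 1 N, f 0 (y:ℤ) +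
      2 * ∑ x ∈ Finset.Icc 1 N, f (x:ℤ) 0 +
      4 * ∑ x ∈ Finset.Icc 1 N, ∑ y ∈ Finset.Icc 1 N, f (x:ℤ) (y:ℤ) := by
  rw [sum_even (fun x => ∑ y ∈ boxZ N, f x y) (by intro x; simp [h1])]
  simp only [sum_even _ (h2 _)]
  rw [Finset.sum_add_distrib, ← Finset.mul_sum]
  ring

lemma cast_mod (n : ℕ) (r : ℕ) (h : n % 3 = r) : ((n : ℤ) : ZMod 3) = (r : ZMod 3) := by
  subst h; simp

lemma case_two (n : ℕ) (h : n % 3 = 2) : (AG n).re = 4 * gamma4 n := by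
  have e : ∀ x y : ℤ, (if x ^ 2 + y ^ 2 = (n:ℤ) then fR x y else 0) =
      if x ^ 2 + y ^ 2 = (n:ℤ) then -2 * (c3 x * c3 y * x * y) else 0 := by
    intro x y
    split_ifs with hc
    · have hc' := congrArg (Int.cast : ℤ → ZMod 3) hc
      rw [cast_mod n 2 h] at hc'
      push_cast at hc'
      have key : ∀ x y : ZMod 3, x ^ 2 + y ^ 2 = 2 → e3 (x ^ 2 - y ^ 2) = 0 := by decide
      have h0 : c3 (x ^ 2 - y ^ 2) = 0 := by
        unfold c3; push_cast; exact key _ _ hc'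
      rw [fR, h0, c3_mul]; ring
    · rfl
  have z : c3 0 = 0 := by decide
  rw [AG_re]
  simp only [e]
  rw [sum_even2]
  · have h1 : ¬ n % 3 = 1 := by omega
    simp only [gamma4, h1, h, if_true, if_false, Finset.sum_filter, Finset.sum_product]
    simp only [z, mul_zero, zero_mul, ite_self, Finset.sum_const_zero, zero_add]
    rw [Finset.mul_sum (a := (-2:ℤ))]
    congr 1
    refine Finset.sum_congr rfl fun x _ => ?_
    rw [Finset.mul_sum]
    refine Finset.sum_congr rfl fun y _ => ?_
    have : ((x:ℤ) ^ 2 + (y:ℤ) ^ 2 = (n:ℤ)) ↔ x ^ 2 + y ^ 2 = n := by norm_cast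
    simp only [this, c3_nat, mul_ite, mul_zero]
  · intro x y; simp [c3_neg]
  · intro x y; simp [c3_neg]

def gR (x y : ℤ) : ℤ := if 3 ∣ y then x ^ 2 - y ^ 2 else 0

lemma case_one (n : ℕ) (hn : 0 < n) (h : n % 3 = 1) : (AG n).re = 4 * gamma4 n := by
  have e : ∀ x y : ℤ, (if x ^ 2 + y ^ 2 = (n:ℤ) then fR x y else 0) =
      (if x ^ 2 + y ^ 2 = (n:ℤ) then gR x y else 0) +
      (if y ^ 2 + x ^ 2 = (n:ℤ) then gR y x else 0) := by
    intro x y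
    rw [add_comm (y ^ 2)]
    split_ifs with hc
    · have hc' := congrArg (Int.cast : ℤ → ZMod 3) hc
      rw [cast_mod n 1 h] at hc'
      push_cast at hc'
      have hx := ZMod.intCast_zmod_eq_zero_iff_dvd x 3
      have hy := ZMod.intCast_zmod_eq_zero_iff_dvd y 3
      push_cast at hx hy
      have key : ∀ x y : ZMod 3, x ^ 2 + y ^ 2 = 1 → e3 (x * y) = 0 ∧
        ((x ≠ 0 ∧ y = 0 ∧ e3 (x ^ 2 - y ^ 2) = 1) ∨ (x = 0 ∧ y ≠ 0 ∧ e3 (x ^ 2 - y ^ 2) = -1)) := by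
        decide
      obtain ⟨h1, h2⟩ := key _ _ hc'
      have h1' : c3 (x * y) = 0 := by unfold c3; push_cast; exact h1
      have h2' : c3 (x ^ 2 - y ^ 2) = e3 ((x : ZMod 3) ^ 2 - (y : ZMod 3) ^ 2) := by
        unfold c3; push_cast; rfl
      rw [fR, gR, gR, h1', h2']
      rw [ne_eq, ne_eq, hx, hy] at h2
      rcases h2 with ⟨a, b, c⟩ | ⟨a, b, c⟩
      · rw [c, if_pos b, if_neg a]; ring
      · rw [c, if_neg b, if_pos a]; ring
    · rfl
  rw [AG_re]
  simp only [e, Finset.sum_add_distrib]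
  rw [Finset.sum_comm (f := fun x y : ℤ => if y ^ 2 + x ^ 2 = (n:ℤ) then gR y x else 0), ← two_mul,
    sum_even2]
  · simp only [gamma4, h, if_true]
    have t0 : (if (0:ℤ) ^ 2 + 0 ^ 2 = (n:ℤ) then gR 0 0 else 0) = 0 := by simp [gR]
    have t1 : ∑ y ∈ Finset.Icc 1 n, (if (0:ℤ) ^ 2 + (y:ℤ) ^ 2 = (n:ℤ) then gR 0 (y:ℤ) else 0) = 0 := by
      apply Finset.sum_eq_zero
      intro y _
      split_ifs with hc
      · rw [gR, if_neg]
        rintro ⟨z, hz⟩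
        rw [hz] at hc
        have : (n:ℤ) = 3 * (3 * z ^ 2) := by linarith
        omega
      · rfl
    have t2 : ∑ x ∈ Finset.Icc 1 n, (if (x:ℤ) ^ 2 + 0 ^ 2 = (n:ℤ) then gR (x:ℤ) 0 else 0) =
        if Nat.sqrt n * Nat.sqrt n = n then (n:ℤ) else 0 := by
      have : ∀ x ∈ Finset.Icc 1 n, (if (x:ℤ) ^ 2 + 0 ^ 2 = (n:ℤ) then gR (x:ℤ) 0 else 0) =
          if Nat.sqrt n = x then (if Nat.sqrt n * Nat.sqrt n = n then (n:ℤ) else 0) else 0 := by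
        intro x _
        have hh : ((x:ℤ) ^ 2 + 0 ^ 2 = (n:ℤ)) ↔ x * x = n := by
          rw [← pow_two]; simp; norm_cast
        simp only [hh]
        by_cases hx : x * x = n
        · have : Nat.sqrt n = x := by rw [← hx, Nat.sqrt_eq]
          rw [if_pos hx, if_pos this, this, if_pos hx, gR, if_pos (dvd_zero _), ← hx]
          push_cast; ring
        · rw [if_neg hx]
          split_ifs with h1 h2
          · rw [h1] at h2; exact absurd h2 hx
          · rfl
          · rfl
      rw [Finset.sum_congr rfl this, Finset.sum_ite_eq, if_pos]
      rw [Finset.mem_Icc]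
      exact ⟨Nat.sqrt_pos.2 hn, Nat.sqrt_le_self n⟩
    have t3 : ∑ x ∈ Finset.Icc 1 n, ∑ y ∈ Finset.Icc 1 n,
        (if (x:ℤ) ^ 2 + (y:ℤ) ^ 2 = (n:ℤ) then gR (x:ℤ) (y:ℤ) else 0) =
        ∑ p ∈ (Finset.Icc 1 n ×ˢ Finset.Icc 1 n).filter (fun p => p.1 ^ 2 + 9 * p.2 ^ 2 = n),
          ((p.1 : ℤ) ^ 2 - 9 * (p.2 : ℤ) ^ 2) := by
      rw [← Finset.sum_product', ← Finset.sum_filter]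
      symm
      refine Finset.sum_of_injOn (fun p => (p.1, 3 * p.2)) ?_ ?_ ?_ ?_
      · rintro ⟨a, b⟩ _ ⟨c, d⟩ _ hh
        simp only [Prod.mk.injEq] at hh ⊢
        omega
      · rintro ⟨a, b⟩ hh
        simp only [Finset.coe_filter, Finset.mem_product, Finset.mem_Icc, Set.mem_setOf_eq] at hh ⊢
        obtain ⟨⟨⟨h1, h2⟩, h3, h4⟩, h5⟩ := hh
        refine ⟨⟨⟨h1, h2⟩, by omega, by nlinarith⟩, ?_⟩
        rw [← h5]; push_cast; ring
      · rintro ⟨a, b⟩ hh hn'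
        simp only [Finset.mem_filter, Finset.mem_product, Finset.mem_Icc] at hh
        obtain ⟨⟨⟨h1, h2⟩, h3, h4⟩, h5⟩ := hh
        rw [gR, if_neg]
        intro h6
        apply hn'
        have h7 : 3 ∣ b := by exact_mod_cast h6
        obtain ⟨c, rfl⟩ := h7
        refine ⟨(a, c), ?_, rfl⟩
        simp only [Finset.coe_filter, Finset.mem_product, Finset.mem_Icc, Set.mem_setOf_eq]
        refine ⟨⟨⟨h1, h2⟩, by omega, by omega⟩, ?_⟩
        have : a ^ 2 + (3 * c) ^ 2 = n := by exact_mod_cast h5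
        rw [← this]; ring
      · rintro ⟨a, b⟩ _
        simp only [gR]
        rw [if_pos (by push_cast; exact dvd_mul_right _ _)]
        push_cast; ring
    rw [t0, t1, t2, t3]
    ring
  · intro x y; simp [gR]
  · intro x y; simp [gR]

theorem gamma4_vanishing (n : ℕ) (hn : 0 < n) :
    gamma4 n = 0 ↔
      3 ∣ n ∨ ∃ p : ℕ, p.Prime ∧ p % 4 = 3 ∧ Odd (padicValNat p n) := by
  by_cases h3 : 3 ∣ n
  · have h1 : ¬ n % 3 = 1 := by omega
    have h2 : ¬ n % 3 = 2 := by omega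
    simp [gamma4, h1, h2, h3]
  have hre : (AG n).re = 4 * gamma4 n := by
    have : n % 3 = 1 ∨ n % 3 = 2 := by omega
    rcases this with h | h
    · exact case_one n hn h
    · exact case_two n h
  constructor
  · intro h0
    right
    by_contra hcon
    refine AG_ne_zero n hn h3 ?_ ?_
    · intro p hp hp4
      by_contra ho
      exact hcon ⟨p, hp, hp4, Nat.not_even_iff_odd.1 ho⟩
    · apply Zsqrtd.ext
      · rw [hre, h0]; rfl
      · rw [AG_im]; rfl
  · rintro (h | ⟨p, hp, hp4, ho⟩)
    · exact absurd h h3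
    have hS : AG n = 0 := by
      rw [AG]
      have : SG n = ∅ := by
        rw [Finset.eq_empty_iff_forall_notMem]
        intro a ha
        rw [mem_SG, norm_def'] at ha
        have hsq : n = a.re.natAbs ^ 2 + a.im.natAbs ^ 2 := by
          zify; simp [← ha]
        have hh := Nat.eq_sq_add_sq_iff.1 ⟨_, _, hsq⟩
        have hpn : p ∣ n := by
          by_contra hc
          rw [padicValNat.eq_zero_of_not_dvd hc] at ho
          simp at ho
        have := hh (q := p) (Nat.mem_primeFactors.2 ⟨hp, hpn, hn.ne'⟩) hp4
        exact (Nat.not_even_iff_odd.2 ho) this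
      rw [this, Finset.sum_empty]
    rw [hS] at hre
    have : (0 : GaussianInt).re = 0 := rfl
    omega
end

section
/- For every positive integer n with n ≡ 3 (mod 8), the sum Σ over pairs of positive integers (n₁,n₂) with n₁²+2n₂² = n of χ₈(n₁)·χ_{−4}(n₂)·n₂ equals 0 if and only if there exists a prime p with p ≡ 5 (mod 8) or p ≡ 7 (mod 8) such that ord_p(n) is odd. -/
open Finset

/-- The Kronecker symbol `(2/·)`. -/
def χ₈ (m : ℕ) : ℤ :=
  if m % 8 = 1 ∨ m % 8 = 7 then 1 else if m % 8 = 3 ∨ m % 8 = 5 then -1 else 0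

/-- The quadratic character modulo 4. -/
def χm4 (m : ℕ) : ℤ := if m % 4 = 1 then 1 else if m % 4 = 3 then -1 else 0


/-- exponent of the order-four character -/
def ee (x y : ZMod 8) : ℕ :=
  if y.val % 2 = 0 then (if x.val = 1 ∨ x.val = 3 then 0 else 2)
  else if ((x.val = 1 ∨ x.val = 7) ↔ y.val % 4 = 1) then 1 else 3

theorem ee_mul : ∀ x y x' y' : ZMod 8, x.val % 2 = 1 → x'.val % 2 = 1 →
    ee (x * x' - 2 * y * y') (x * y' + y * x') % 4 = (ee x y + ee x' y') % 4 := by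
  decide +kernel

theorem zmod8_val_odd (x : ℤ) (hx : x % 2 = 1) : ((x : ZMod 8)).val % 2 = 1 := by
  have h : (((x : ZMod 8).val : ℕ) : ℤ) = x % 8 := ZMod.val_intCast x
  omega

noncomputable def eps (α : ℤ√(-2)) : ℂ := Complex.I ^ (ee (α.re : ZMod 8) (α.im : ZMod 8))

theorem I_pow_congr {a b : ℕ} (h : a % 4 = b % 4) : Complex.I ^ a = Complex.I ^ b := by
  rw [Complex.I_pow_eq_pow_mod a, Complex.I_pow_eq_pow_mod b, h]

theorem eps_mul (α β : ℤ√(-2)) (ha : α.re % 2 = 1) (hb : β.re % 2 = 1) :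
    eps (α * β) = eps α * eps β := by
  unfold eps
  rw [← pow_add]
  apply I_pow_congr
  rw [← ee_mul _ _ _ _ (zmod8_val_odd _ ha) (zmod8_val_odd _ hb)]
  simp only [Zsqrtd.re_mul, Zsqrtd.im_mul]
  push_cast
  congr 2
  ring

theorem eps_pow4 (α : ℤ√(-2)) : eps α ^ 4 = 1 := by
  unfold eps
  rw [← pow_mul, mul_comm, pow_mul, Complex.I_pow_four, one_pow]

noncomputable def toC : ℤ√(-2) →+* ℂ :=
  Zsqrtd.lift ⟨Complex.I * (Real.sqrt 2 : ℂ), by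
    have h : ((Real.sqrt 2 : ℝ) : ℂ) * ((Real.sqrt 2 : ℝ) : ℂ) = 2 := by
      rw [← Complex.ofReal_mul, Real.mul_self_sqrt (by norm_num)]; norm_num
    push_cast
    linear_combination (Complex.I * Complex.I) * h + 2 * Complex.I_mul_I⟩

theorem toC_inj : Function.Injective toC := by
  apply Zsqrtd.lift_injective
  intro n
  nlinarith [mul_self_nonneg n]

instance : IsDomain (ℤ√(-2)) := toC_inj.isDomain toC

theorem toC_apply (α : ℤ√(-2)) :
    toC α = (α.re : ℂ) + (α.im : ℂ) * (Complex.I * (Real.sqrt 2 : ℂ)) := by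
  simp [toC]

noncomputable def psi (α : ℤ√(-2)) : ℂ := eps α * toC α

theorem psi_mul (α β : ℤ√(-2)) (ha : α.re % 2 = 1) (hb : β.re % 2 = 1) :
    psi (α * β) = psi α * psi β := by
  unfold psi
  rw [eps_mul α β ha hb, map_mul]
  ring

theorem psi_pow4 (α : ℤ√(-2)) : psi α ^ 4 = toC (α ^ 4) := by
  unfold psi
  rw [mul_pow, eps_pow4, map_pow, one_mul]

theorem norm_eq (α : ℤ√(-2)) : α.norm = α.re ^ 2 + 2 * α.im ^ 2 := by
  rw [Zsqrtd.norm_def]; ring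

theorem re_odd_of_norm {α : ℤ√(-2)} (h : α.norm % 2 = 1) : α.re % 2 = 1 := by
  rw [norm_eq] at h
  rcases Int.emod_two_eq_zero_or_one α.re with h0 | h0
  · exfalso
    obtain ⟨k, hk⟩ := Int.dvd_of_emod_eq_zero h0
    rw [hk] at h
    have : (2 * k) ^ 2 + 2 * α.im ^ 2 = 2 * (2 * k ^ 2 + α.im ^ 2) := by ring
    omega
  · exact h0

theorem re_odd_mul {α β : ℤ√(-2)} (ha : α.norm % 2 = 1) (hb : β.norm % 2 = 1) :
    (α * β).norm % 2 = 1 := by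
  rw [Zsqrtd.norm_mul, Int.mul_emod, ha, hb]; rfl

theorem norm_pow_odd {α : ℤ√(-2)} (ha : α.norm % 2 = 1) (k : ℕ) : (α ^ k).norm % 2 = 1 := by
  induction k with
  | zero => simp
  | succ k ih => rw [pow_succ]; exact re_odd_mul ih ha

theorem psi_one : psi 1 = 1 := by
  have : ee (1 : ZMod 8) 0 = 0 := by decide
  simp [psi, eps, this]

theorem psi_neg_one : psi (-1) = 1 := by
  have : ee (-1 : ZMod 8) 0 = 2 := by decide
  simp [psi, eps, this]

theorem psi_pow (α : ℤ√(-2)) (ha : α.norm % 2 = 1) (k : ℕ) : psi (α ^ k) = psi α ^ k := by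
  induction k with
  | zero => simp [psi_one]
  | succ k ih =>
    rw [pow_succ, pow_succ, psi_mul _ _ (re_odd_of_norm (norm_pow_odd ha k)) (re_odd_of_norm ha), ih]

theorem finite_norm (n : ℕ) : {α : ℤ√(-2) | α.norm = n}.Finite := by
  apply Set.Finite.subset
    (s := (fun q : ℤ × ℤ => (⟨q.1, q.2⟩ : ℤ√(-2))) '' (Set.Icc (-(n:ℤ)) n ×ˢ Set.Icc (-(n:ℤ)) n))
  · exact ((Set.finite_Icc _ _).prod (Set.finite_Icc _ _)).image _
  · intro α h
    simp only [Set.mem_ofPred_eq, norm_eq] at h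
    refine ⟨(α.re, α.im), ⟨⟨?_, ?_⟩, ⟨?_, ?_⟩⟩, rfl⟩ <;> simp only <;>
      nlinarith [sq_nonneg α.re, sq_nonneg α.im, sq_nonneg (α.re - 1), sq_nonneg (α.re + 1),
        sq_nonneg (α.im - 1), sq_nonneg (α.im + 1), Int.le_self_sq α.re, Int.le_self_sq (-α.re),
        Int.le_self_sq α.im, Int.le_self_sq (-α.im)]

noncomputable def NS (n : ℕ) : Finset (ℤ√(-2)) := (finite_norm n).toFinset

theorem mem_NS {n : ℕ} {α : ℤ√(-2)} : α ∈ NS n ↔ α.norm = n := by simp [NS]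

noncomputable def TT (n : ℕ) : ℂ := ∑ α ∈ NS n, psi α

theorem TT_one : TT 1 = 2 := by
  have : NS 1 = {1, -1} := by
    ext α
    rw [mem_NS, norm_eq]
    simp only [Finset.mem_insert, Finset.mem_singleton, Zsqrtd.ext_iff]
    constructor
    · intro h
      have him : α.im = 0 := by
        by_contra h0
        have : 0 < α.im ^ 2 := by positivity
        have := sq_nonneg α.re
        push_cast at h
        omega
      have h1 : α.re ^ 2 = 1 := by rw [him] at h; simpa using h
      rcases (show α.re = 1 ∨ α.re = -1 from by simpa using h1) with h | h <;> simp [h, him]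
    · rintro (⟨h, h'⟩ | ⟨h, h'⟩) <;> simp [h, h']
  unfold TT
  rw [this, Finset.sum_pair, psi_one, psi_neg_one]
  · norm_num
  · intro h
    have := congrArg Zsqrtd.re h
    simp at this

/-- the residue map at a split prime -/
theorem residue (p : ℕ) (hp : p.Prime) (hp2 : p ≠ 2) (π : ℤ√(-2)) (hπ : π.norm = p) :
    ∃ φ : ℤ√(-2) →+* ZMod p, (∀ α, φ α = 0 ↔ π ∣ α) ∧ φ (star π) ≠ 0 := by
  have : Fact p.Prime := ⟨hp⟩
  have h2 : (2 : ZMod p) ≠ 0 := by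
    intro h
    have : ((2 : ℕ) : ZMod p) = 0 := by exact_mod_cast h
    rw [ZMod.natCast_eq_zero_iff] at this
    exact hp2 ((Nat.prime_dvd_prime_iff_eq hp Nat.prime_two).mp this)
  have hn : (π.re : ZMod p) ^ 2 + 2 * (π.im : ZMod p) ^ 2 = 0 := by
    have := congrArg (Int.cast : ℤ → ZMod p) hπ
    rw [norm_eq] at this
    push_cast at this
    simpa using this
  have hb : (π.im : ZMod p) ≠ 0 := by
    intro hb
    have ha : (π.re : ZMod p) = 0 := by
      rw [hb] at hn; simpa using hn
    rw [ZMod.intCast_zmod_eq_zero_iff_dvd] at ha hb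
    obtain ⟨c, hc⟩ := ha
    obtain ⟨d, hd⟩ := hb
    rw [norm_eq, hc, hd] at hπ
    have hp0 : (p : ℤ) ≠ 0 := by exact_mod_cast hp.ne_zero
    have : (p : ℤ) * (c ^ 2 + 2 * d ^ 2) = 1 := by
      apply mul_left_cancel₀ hp0
      linear_combination hπ
    have := Int.isUnit_iff.mp (IsUnit.of_mul_eq_one _ this)
    have := hp.two_le
    omega
  obtain ⟨r, hr⟩ : ∃ r : ZMod p, π.im * r = - π.re :=
    ⟨- π.re / π.im, by field_simp⟩
  have hr2 : r * r = -2 := by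
    have : (π.im : ZMod p) ^ 2 * (r * r + 2) = 0 := by
      linear_combination hn + (π.im * r - π.re) * hr
    have := (mul_eq_zero.mp this).resolve_left (pow_ne_zero 2 hb)
    linear_combination this
  refine ⟨Zsqrtd.lift ⟨r, by rw [hr2]; push_cast; rfl⟩, ?_, ?_⟩
  · intro α
    simp only [Zsqrtd.lift_apply_apply]
    constructor
    · intro h
      have h1 : (p : ℤ) ∣ (α * star π).re := by
        rw [← ZMod.intCast_zmod_eq_zero_iff_dvd]
        simp only [Zsqrtd.re_mul, Zsqrtd.re_star, Zsqrtd.im_star]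
        push_cast
        linear_combination (π.re : ZMod p) * h - α.im * r * hr + α.im * π.im * hr2
      have h2 : (p : ℤ) ∣ (α * star π).im := by
        rw [← ZMod.intCast_zmod_eq_zero_iff_dvd]
        simp only [Zsqrtd.im_mul, Zsqrtd.re_star, Zsqrtd.im_star]
        push_cast
        linear_combination -(π.im : ZMod p) * h + α.im * hr
      have h3 : ((p : ℤ) : ℤ√(-2)) ∣ α * star π := (Zsqrtd.intCast_dvd _ _).mpr ⟨h1, h2⟩
      rw [← hπ, Zsqrtd.norm_eq_mul_conj] at h3
      obtain ⟨q, hq⟩ := h3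
      have hs : star π ≠ 0 := by
        intro h0
        have : π = 0 := by simpa using h0
        rw [this] at hb; simp at hb
      refine ⟨q, mul_right_cancel₀ hs ?_⟩
      rw [hq]; ring
    · rintro ⟨q, rfl⟩
      simp only [Zsqrtd.re_mul, Zsqrtd.im_mul]
      push_cast
      linear_combination (q.re + q.im * r) * hr - π.im * q.im * hr2
  · simp only [Zsqrtd.lift_apply_apply, Zsqrtd.re_star, Zsqrtd.im_star]
    push_cast
    intro h
    have h4 : (2 : ZMod p) * π.re = 0 := by linear_combination h + hr
    have ha := (mul_eq_zero.mp h4).resolve_left h2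
    rw [ha] at hn
    have : (2 : ZMod p) * π.im ^ 2 = 0 := by linear_combination hn
    exact (mul_eq_zero.mp this).elim h2 (fun h => hb (pow_eq_zero_iff (two_ne_zero) |>.mp h))

theorem zs_norm_star (α : ℤ√(-2)) : (star α).norm = α.norm := by
  simp [norm_eq]

theorem split_or {p : ℕ} (hp : p.Prime) (hp2 : p ≠ 2) {π : ℤ√(-2)} (hπ : π.norm = p)
    {α : ℤ√(-2)} (h : (p : ℤ) ∣ α.norm) : π ∣ α ∨ star π ∣ α := by
  have : Fact p.Prime := ⟨hp⟩
  obtain ⟨φ, h1, -⟩ := residue p hp hp2 π hπ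
  have : φ α * φ (star α) = 0 := by
    rw [← map_mul, ← Zsqrtd.norm_eq_mul_conj, map_intCast, ZMod.intCast_zmod_eq_zero_iff_dvd]
    exact h
  rcases mul_eq_zero.mp this with h | h
  · exact Or.inl ((h1 _).mp h)
  · right
    obtain ⟨q, hq⟩ := (h1 _).mp h
    refine ⟨star q, ?_⟩
    have := congrArg star hq
    rw [star_star, star_mul] at this
    rw [this, mul_comm]

theorem split_pow {p : ℕ} (hp : p.Prime) (hp2 : p ≠ 2) {π : ℤ√(-2)} (hπ : π.norm = p)
    (m k : ℕ) : ∀ α : ℤ√(-2), α.norm = (p ^ k * m : ℕ) → ¬ π ∣ α →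
    ∃ γ : ℤ√(-2), γ.norm = m ∧ α = (star π) ^ k * γ := by
  have hp0 : (p : ℤ) ≠ 0 := by exact_mod_cast hp.ne_zero
  induction k with
  | zero => intro α h _; exact ⟨α, by simpa using h, by simp⟩
  | succ k ih =>
    intro α h hn
    have hd : (p : ℤ) ∣ α.norm := by rw [h]; exact ⟨(p : ℤ) ^ k * m, by push_cast; ring⟩
    obtain ⟨β, rfl⟩ := (split_or hp hp2 hπ hd).resolve_left hn
    rw [Zsqrtd.norm_mul, zs_norm_star, hπ] at h
    obtain ⟨γ, h1, h2⟩ := ih β (by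
      apply mul_left_cancel₀ hp0
      rw [h]; push_cast; ring) (fun hh => hn (hh.mul_left _))
    exact ⟨γ, h1, by rw [h2]; ring⟩

theorem TT_split_step {p : ℕ} (hp : p.Prime) (hp2 : p ≠ 2) {π : ℤ√(-2)} (hπ : π.norm = p)
    (m k : ℕ) (hm : m % 2 = 1) (hpm : ¬ p ∣ m) :
    TT (p ^ (k + 1) * m) = psi π * TT (p ^ k * m) + psi (star π) ^ (k + 1) * TT m := by
  classical
  have : Fact p.Prime := ⟨hp⟩
  have hpo : p % 2 = 1 := hp.eq_two_or_odd.resolve_left hp2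
  have hpo' : π.norm % 2 = 1 := by rw [hπ]; omega
  have hso' : (star π).norm % 2 = 1 := by rw [zs_norm_star]; exact hpo'
  have hp0 : (p : ℤ) ≠ 0 := by exact_mod_cast hp.ne_zero
  have hπ0 : π ≠ 0 := by rintro rfl; simp at hpo'
  have hs0 : star π ≠ 0 := by simpa using hπ0
  have hpk : (p ^ k * m) % 2 = 1 := by
    rw [← Nat.odd_iff] at *
    exact (hpo.pow).mul hm
  obtain ⟨φ, h1, h2⟩ := residue p hp hp2 π hπ
  have key : NS (p ^ (k + 1) * m) =
      (NS (p ^ k * m)).image (fun β => π * β) ∪ (NS m).image (fun γ => star π ^ (k + 1) * γ) := by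
    ext α
    simp only [Finset.mem_union, Finset.mem_image, mem_NS]
    constructor
    · intro h
      by_cases hd : π ∣ α
      · obtain ⟨β, rfl⟩ := hd
        refine Or.inl ⟨β, ?_, rfl⟩
        rw [Zsqrtd.norm_mul, hπ] at h
        apply mul_left_cancel₀ hp0
        rw [h]; push_cast; ring
      · obtain ⟨γ, h3, h4⟩ := split_pow hp hp2 hπ m (k + 1) α h hd
        exact Or.inr ⟨γ, h3, h4.symm⟩
    · rintro (⟨β, h, rfl⟩ | ⟨γ, h, rfl⟩)
      · rw [Zsqrtd.norm_mul, hπ, h]; push_cast; ring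
      · have : ∀ j : ℕ, (star π ^ j).norm = (p : ℤ) ^ j := by
          intro j
          induction j with
          | zero => simp
          | succ j ih => rw [pow_succ, Zsqrtd.norm_mul, ih, zs_norm_star, hπ, pow_succ]
        rw [Zsqrtd.norm_mul, this, h]; push_cast; ring
  have disj : Disjoint ((NS (p ^ k * m)).image (fun β => π * β))
      ((NS m).image (fun γ => star π ^ (k + 1) * γ)) := by
    rw [Finset.disjoint_left]
    intro α ha hb
    simp only [Finset.mem_image, mem_NS] at ha hb
    obtain ⟨β, -, rfl⟩ := ha
    obtain ⟨γ, h3, h4⟩ := hb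
    have : φ (star π ^ (k + 1) * γ) = 0 := (h1 _).mpr ⟨β, h4⟩
    rw [map_mul, map_pow] at this
    have hγ := (mul_eq_zero.mp this).resolve_left (pow_ne_zero _ h2)
    have : φ (γ * star γ) = 0 := by rw [map_mul, hγ, zero_mul]
    rw [← Zsqrtd.norm_eq_mul_conj, map_intCast, ZMod.intCast_zmod_eq_zero_iff_dvd, h3] at this
    exact hpm (by exact_mod_cast this)
  unfold TT
  rw [key, Finset.sum_union disj, Finset.sum_image, Finset.sum_image, Finset.mul_sum,
    Finset.mul_sum]
  · congr 1
    · apply Finset.sum_congr rfl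
      intro β hβ
      rw [mem_NS] at hβ
      exact psi_mul _ _ (re_odd_of_norm hpo') (re_odd_of_norm (by rw [hβ]; omega))
    · apply Finset.sum_congr rfl
      intro β hβ
      rw [mem_NS] at hβ
      rw [psi_mul _ _ (re_odd_of_norm (norm_pow_odd hso' _)) (re_odd_of_norm (by rw [hβ]; omega)),
        psi_pow _ hso']
  · intro x _ y _ h
    exact mul_left_cancel₀ (pow_ne_zero _ hs0) h
  · intro x _ y _ h
    exact mul_left_cancel₀ hπ0 h

theorem TT_split {p : ℕ} (hp : p.Prime) (hp2 : p ≠ 2) {π : ℤ√(-2)} (hπ : π.norm = p)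
    (m k : ℕ) (hm : m % 2 = 1) (hpm : ¬ p ∣ m) :
    (psi π - psi (star π)) * TT (p ^ k * m) =
      (psi π ^ (k + 1) - psi (star π) ^ (k + 1)) * TT m := by
  induction k with
  | zero => simp
  | succ k ih =>
    rw [TT_split_step hp hp2 hπ m k hm hpm]
    linear_combination (psi π) * ih

theorem TT_split_ne {p : ℕ} (hp : p.Prime) (hp2 : p ≠ 2) {π : ℤ√(-2)} (hπ : π.norm = p)
    (m k : ℕ) (hm : m % 2 = 1) (hpm : ¬ p ∣ m) (h0 : TT m ≠ 0) : TT (p ^ k * m) ≠ 0 := by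
  have : Fact p.Prime := ⟨hp⟩
  intro h
  have h1 := TT_split hp hp2 hπ m k hm hpm
  rw [h, mul_zero] at h1
  have h2 := (mul_eq_zero.mp h1.symm).resolve_right h0
  have h3 : psi π ^ (k + 1) = psi (star π) ^ (k + 1) := sub_eq_zero.mp h2
  have h4 : (psi π ^ 4) ^ (k + 1) = (psi (star π) ^ 4) ^ (k + 1) := by
    rw [← pow_mul, ← pow_mul, mul_comm, pow_mul, pow_mul, h3]
  rw [psi_pow4, psi_pow4, ← map_pow, ← map_pow] at h4
  have h5 := toC_inj h4
  obtain ⟨φ, h6, h7⟩ := residue p hp hp2 π hπ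
  have h8 := congrArg φ h5
  simp only [map_pow] at h8
  rw [(h6 π).mpr dvd_rfl] at h8
  have : φ (star π) = 0 := by
    simpa using h8.symm
  exact h7 this

theorem inert_dvd {p : ℕ} (hp : p.Prime) (h : p % 8 = 5 ∨ p % 8 = 7) (x y : ℤ)
    (hd : (p : ℤ) ∣ x ^ 2 + 2 * y ^ 2) : (p : ℤ) ∣ x ∧ (p : ℤ) ∣ y := by
  have : Fact p.Prime := ⟨hp⟩
  have hns : ¬ IsSquare (-2 : ZMod p) := by
    rw [ZMod.exists_sq_eq_neg_two_iff (by omega)]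
    omega
  rw [← ZMod.intCast_zmod_eq_zero_iff_dvd] at hd
  rw [← ZMod.intCast_zmod_eq_zero_iff_dvd, ← ZMod.intCast_zmod_eq_zero_iff_dvd]
  push_cast at hd
  by_cases hy : (y : ZMod p) = 0
  · rw [hy] at hd
    exact ⟨by simpa using hd, hy⟩
  · exfalso
    apply hns
    refine ⟨x / y, ?_⟩
    field_simp
    linear_combination -hd

theorem TT_inert {p : ℕ} (hp : p.Prime) (h : p % 8 = 5 ∨ p % 8 = 7) (m : ℕ) (hm : m % 2 = 1) :
    TT (p ^ 2 * m) = psi (p : ℤ√(-2)) * TT m := by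
  classical
  have hp0 : (p : ℤ) ≠ 0 := by exact_mod_cast hp.ne_zero
  have hP : ((p : ℤ√(-2))).norm = (p : ℤ) ^ 2 := by
    rw [norm_eq]; simp
  have hPre : ((p : ℤ√(-2))).re % 2 = 1 := by simp; omega
  have hP0 : (p : ℤ√(-2)) ≠ 0 := by exact_mod_cast hp.ne_zero
  have key : NS (p ^ 2 * m) = (NS m).image (fun β => (p : ℤ√(-2)) * β) := by
    ext α
    simp only [Finset.mem_image, mem_NS]
    constructor
    · intro hα
      have h1 := inert_dvd hp h α.re α.im (by
        rw [← norm_eq, hα]; exact ⟨p * m, by push_cast; ring⟩)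
      have h2 := (Zsqrtd.intCast_dvd _ _).mpr h1
      obtain ⟨β, rfl⟩ := h2
      refine ⟨β, ?_, by simp⟩
      rw [Zsqrtd.norm_mul] at hα
      apply mul_left_cancel₀ (pow_ne_zero 2 hp0)
      rw [Int.cast_natCast, hP] at hα
      rw [hα]; push_cast; ring
    · rintro ⟨β, hβ, rfl⟩
      rw [Zsqrtd.norm_mul, hP, hβ]; push_cast; ring
  unfold TT
  rw [key, Finset.sum_image, Finset.mul_sum]
  · apply Finset.sum_congr rfl
    intro β hβ
    rw [mem_NS] at hβ
    exact psi_mul _ _ hPre (re_odd_of_norm (by rw [hβ]; omega))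
  · intro x _ y _ h
    exact mul_left_cancel₀ hP0 h

theorem psi_ne_zero {α : ℤ√(-2)} (h : α ≠ 0) : psi α ≠ 0 := by
  unfold psi eps
  exact mul_ne_zero (pow_ne_zero _ Complex.I_ne_zero) (fun h' => h (toC_inj (by rw [h', map_zero])))

theorem descent (p : ℕ) (hp : p.Prime) : ∀ m : ℕ, 0 < m → m < p →
    (∃ x y : ℤ, x ^ 2 + 2 * y ^ 2 = m * p) → ∃ x y : ℤ, x ^ 2 + 2 * y ^ 2 = p := by
  intro m
  induction m using Nat.strong_induction_on with
  | _ m ih =>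
    intro hm0 hmp ⟨x, y, hxy⟩
    by_cases hm1 : m = 1
    · subst hm1; exact ⟨x, y, by simpa using hxy⟩
    have hb : ∀ z : ℤ, ∃ u c : ℤ, z = u + m * c ∧ 4 * u ^ 2 ≤ (m : ℤ) ^ 2 := by
      intro z
      refine ⟨z.bmod m, z.bdiv m, by have := Int.bmod_add_bdiv z m; linarith, ?_⟩
      have h1 := Int.bmod_le (x := z) hm0
      have h2 := Int.le_bmod (x := z) hm0
      have h3 : 2 * z.bmod m ≤ m := by omega
      have h4 : -(m : ℤ) ≤ 2 * z.bmod m := by omega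
      nlinarith
    obtain ⟨u, c, hu, hu'⟩ := hb x
    obtain ⟨v, d, hv, hv'⟩ := hb y
    have hmz : (0 : ℤ) < m := by exact_mod_cast hm0
    obtain ⟨r, hr⟩ : ∃ r : ℤ, u ^ 2 + 2 * v ^ 2 = m * r :=
      ⟨p - 2 * u * c - m * c ^ 2 - 4 * v * d - 2 * m * d ^ 2, by
        rw [hu, hv] at hxy; linear_combination hxy⟩
    have hr0 : 0 ≤ r := by
      by_contra hneg
      push Not at hneg
      nlinarith [sq_nonneg u, sq_nonneg v]
    have hrm : r < m := by
      by_contra hge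
      push Not at hge
      nlinarith
    rcases hr0.eq_or_lt with hr0 | hr0
    · exfalso
      rw [← hr0, mul_zero] at hr
      have hu0 : u = 0 := by
        have : u ^ 2 = 0 := by nlinarith [sq_nonneg u, sq_nonneg v]
        exact pow_eq_zero_iff two_ne_zero |>.mp this
      have hv0 : v = 0 := by
        have : v ^ 2 = 0 := by nlinarith [sq_nonneg u, sq_nonneg v]
        exact pow_eq_zero_iff two_ne_zero |>.mp this
      rw [hu, hv, hu0, hv0] at hxy
      have : (m : ℤ) ∣ p := ⟨c ^ 2 + 2 * d ^ 2, by
        apply mul_left_cancel₀ hmz.ne'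
        linear_combination -hxy⟩
      have h5 : m ∣ p := by exact_mod_cast this
      rcases (Nat.dvd_prime hp).mp h5 with h | h <;> omega
    · -- (x + y s)(u - v s) = (xu + 2yv) + (yu - xv) s, both divisible by m
      lift r to ℕ using hr0.le
      refine ih r (by exact_mod_cast hrm) (by exact_mod_cast hr0) (by omega)
        ⟨r + c * u + 2 * d * v, d * u - c * v, ?_⟩
      have h1 : x * u + 2 * y * v = m * (r + c * u + 2 * d * v) := by
        rw [hu, hv]; linear_combination hr
      have h2 : y * u - x * v = m * (d * u - c * v) := by
        rw [hu, hv]; ring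
      apply mul_left_cancel₀ (pow_ne_zero 2 hmz.ne')
      calc (m : ℤ) ^ 2 * ((r + c * u + 2 * d * v) ^ 2 + 2 * (d * u - c * v) ^ 2)
          = (m * (r + c * u + 2 * d * v)) ^ 2 + 2 * (m * (d * u - c * v)) ^ 2 := by ring
        _ = (x * u + 2 * y * v) ^ 2 + 2 * (y * u - x * v) ^ 2 := by rw [h1, h2]
        _ = (x ^ 2 + 2 * y ^ 2) * (u ^ 2 + 2 * v ^ 2) := by ring
        _ = m ^ 2 * (r * p) := by rw [hxy, hr]; ring

theorem exists_split {p : ℕ} (hp : p.Prime) (h : p % 8 = 1 ∨ p % 8 = 3) :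
    ∃ π : ℤ√(-2), π.norm = p := by
  have : Fact p.Prime := ⟨hp⟩
  obtain ⟨r, hr⟩ := (ZMod.exists_sq_eq_neg_two_iff (p := p) (by omega)).mpr h
  have hp3 : 3 ≤ p := by have := hp.two_le; omega
  -- choose the minimal absolute value representative
  have h1 := r.natAbs_valMinAbs_le
  have h2 : ((r.valMinAbs : ℤ) : ZMod p) = r := r.coe_valMinAbs
  set z := r.valMinAbs
  have h3 : (p : ℤ) ∣ z ^ 2 + 2 * 1 ^ 2 := by
    rw [← ZMod.intCast_zmod_eq_zero_iff_dvd]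
    push_cast
    rw [h2]; linear_combination -hr
  obtain ⟨m, hm⟩ := h3
  have hpz : (3 : ℤ) ≤ p := by exact_mod_cast hp3
  have hz : 4 * z ^ 2 ≤ (p : ℤ) ^ 2 := by
    have : 2 * |z| ≤ p := by
      rw [Int.abs_eq_natAbs]; omega
    have h4 := abs_nonneg z
    rw [← sq_abs z]
    nlinarith
  have hm0 : 0 < m := by
    by_contra hneg
    push Not at hneg
    nlinarith [sq_nonneg z]
  have hmp : m < p := by
    by_contra hge
    push Not at hge
    nlinarith
  lift m to ℕ using hm0.le
  obtain ⟨x, y, hxy⟩ := descent p hp m (by exact_mod_cast hm0) (by exact_mod_cast hmp)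
    ⟨z, 1, by rw [hm]; ring⟩
  exact ⟨⟨x, y⟩, by rw [norm_eq]; exact hxy⟩

theorem TT_ne (n : ℕ) : n % 2 = 1 →
    (∀ p : ℕ, p.Prime → (p % 8 = 5 ∨ p % 8 = 7) → Even (padicValNat p n)) → TT n ≠ 0 := by
  induction n using Nat.strong_induction_on with
  | _ n ih =>
    intro hn hE
    by_cases h1 : n = 1
    · rw [h1, TT_one]; norm_num
    have hn0 : n ≠ 0 := by omega
    obtain ⟨p, hp, hpn⟩ := Nat.exists_prime_and_dvd h1
    have : Fact p.Prime := ⟨hp⟩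
    have hp2 : p ≠ 2 := by rintro rfl; omega
    have hpo : p % 2 = 1 := hp.eq_two_or_odd.resolve_left hp2
    rcases (by omega : (p % 8 = 1 ∨ p % 8 = 3) ∨ (p % 8 = 5 ∨ p % 8 = 7)) with h | h
    · obtain ⟨π, hπ⟩ := exists_split hp h
      obtain ⟨k, m, hm, hk⟩ := Nat.exists_eq_pow_mul_and_not_dvd hn0 p hp.ne_one
      have hm2 : m % 2 = 1 := by
        rw [← Nat.odd_iff] at hn ⊢
        rw [hk] at hn
        exact (Nat.odd_mul.mp hn).2
      have hm0 : m ≠ 0 := by omega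
      have hk0 : k ≠ 0 := by
        rintro rfl
        rw [hk] at hpn; simp at hpn; exact hm hpn
      have hlt : m < n := by
        rw [hk]
        exact (lt_mul_iff_one_lt_left (by omega)).mpr (Nat.one_lt_pow hk0 hp.one_lt)
      rw [hk]
      refine TT_split_ne hp hp2 hπ m k hm2 hm (ih m hlt hm2 ?_)
      intro q hq hq8
      have : Fact q.Prime := ⟨hq⟩
      have := hE q hq hq8
      have hne : q ≠ p := by rintro rfl; omega
      rw [hk, padicValNat.mul (pow_ne_zero _ hp.ne_zero) hm0, padicValNat.pow,
        padicValNat_primes hne] at this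
      simpa using this
    · have hev := hE p hp h
      have hv1 : 1 ≤ padicValNat p n := one_le_padicValNat_of_dvd hn0 hpn
      have hv2 : 2 ≤ padicValNat p n := by
        obtain ⟨c, hc⟩ := hev; omega
      obtain ⟨m, hm⟩ := (padicValNat_dvd_iff_le hn0).mpr hv2
      have hm2 : m % 2 = 1 := by
        rw [← Nat.odd_iff] at hn ⊢
        rw [hm] at hn
        exact (Nat.odd_mul.mp hn).2
      have hm0 : m ≠ 0 := by omega
      have hlt : m < n := by
        rw [hm]
        exact (lt_mul_iff_one_lt_left (by omega)).mpr (Nat.one_lt_pow two_ne_zero hp.one_lt)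
      rw [hm, TT_inert hp h m hm2]
      refine mul_ne_zero (psi_ne_zero (by exact_mod_cast hp.ne_zero)) (ih m hlt hm2 ?_)
      intro q hq hq8
      have : Fact q.Prime := ⟨hq⟩
      have := hE q hq hq8
      rw [hm, padicValNat.mul (pow_ne_zero _ hp.ne_zero) hm0, padicValNat.pow] at this
      rw [Nat.even_add] at this
      exact this.mp (even_two_mul _)

theorem ee_sum : ∀ x y : ZMod 8, x.val % 2 = 1 → y.val % 2 = 1 →
    ee x (-y) % 4 = (ee x y + 2) % 4 ∧ ee (-x) y = ee x y ∧ ee (-x) (-y) % 4 = (ee x y + 2) % 4 := by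
  decide +kernel

theorem ee_chi (x y : ℕ) (hx : x % 2 = 1) (hy : y % 2 = 1) :
    Complex.I ^ ee (x : ZMod 8) (y : ZMod 8) = Complex.I * (χ₈ x * χm4 y : ℤ) := by
  have hI : Complex.I ^ 3 = -Complex.I := Complex.I_pow_three
  unfold ee χ₈ χm4
  rw [ZMod.val_natCast, ZMod.val_natCast]
  have h1 : (y % 8) % 2 = 1 := by omega
  have h2 : (y % 8) % 4 = y % 4 := by omega
  rw [h1, h2]
  have hx' : x % 8 = 1 ∨ x % 8 = 3 ∨ x % 8 = 5 ∨ x % 8 = 7 := by omega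
  have hy' : y % 4 = 1 ∨ y % 4 = 3 := by omega
  rcases hx' with h | h | h | h <;> rcases hy' with h' | h' <;> simp [h, h', hI]

theorem four_sum (x y : ℕ) (hx : x % 2 = 1) (hy : y % 2 = 1) :
    psi ⟨x, y⟩ + psi ⟨x, -y⟩ + (psi ⟨-x, y⟩ + psi ⟨-x, -y⟩) =
      (4 * Complex.I * (Complex.I * (Real.sqrt 2 : ℂ))) * ((χ₈ x * χm4 y * y : ℤ) : ℂ) := by
  have hx' : ((x : ZMod 8)).val % 2 = 1 := by rw [ZMod.val_natCast]; omega
  have hy' : ((y : ZMod 8)).val % 2 = 1 := by rw [ZMod.val_natCast]; omega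
  obtain ⟨h1, h2, h3⟩ := ee_sum x y hx' hy'
  have h1 := I_pow_congr h1
  have h3 := I_pow_congr h3
  rw [pow_add, Complex.I_sq] at h1 h3
  simp only [psi, eps, toC_apply]
  push_cast
  rw [h1, h2, h3, ee_chi x y hx hy]
  push_cast
  ring

theorem odd_of_rep {n x y : ℕ} (h8 : n % 8 = 3) (h : x ^ 2 + 2 * y ^ 2 = n) :
    x % 2 = 1 ∧ y % 2 = 1 := by
  have hx : x % 4 = 0 ∨ x % 4 = 1 ∨ x % 4 = 2 ∨ x % 4 = 3 := by omega
  have hy : y % 4 = 0 ∨ y % 4 = 1 ∨ y % 4 = 2 ∨ y % 4 = 3 := by omega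
  have h4 : n % 4 = 3 := by omega
  have h5 : (x ^ 2 + 2 * y ^ 2) % 4 = 3 := by rw [h]; exact h4
  rcases hx with hx | hx | hx | hx <;> rcases hy with hy | hy | hy | hy <;>
    simp [Nat.add_mod, Nat.mul_mod, Nat.pow_mod, hx, hy] at h5 <;> omega

theorem TT_eq (n : ℕ) (h8 : n % 8 = 3) :
    TT n = (4 * Complex.I * (Complex.I * (Real.sqrt 2 : ℂ))) *
      ((∑ p ∈ (Finset.Icc 1 n ×ˢ Finset.Icc 1 n).filter (fun p => p.1 ^ 2 + 2 * p.2 ^ 2 = n),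
        χ₈ p.1 * χm4 p.2 * p.2 : ℤ) : ℂ) := by
  classical
  set P := (Finset.Icc 1 n ×ˢ Finset.Icc 1 n).filter (fun p => p.1 ^ 2 + 2 * p.2 ^ 2 = n) with hP
  have hfib : TT n = ∑ q ∈ P, ∑ α ∈ (NS n).filter (fun α => (α.re.natAbs, α.im.natAbs) = q),
      psi α := by
    unfold TT
    rw [Finset.sum_fiberwise_of_maps_to]
    intro α hα
    rw [mem_NS, norm_eq] at hα
    have h1 : α.re.natAbs ^ 2 + 2 * α.im.natAbs ^ 2 = n := by
      zify
      rw [sq_abs, sq_abs]; exact hα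
    obtain ⟨h2, h3⟩ := odd_of_rep h8 h1
    simp only [hP, Finset.mem_filter, Finset.mem_product, Finset.mem_Icc]
    refine ⟨⟨⟨by omega, ?_⟩, ⟨by omega, ?_⟩⟩, h1⟩ <;> nlinarith
  rw [hfib]
  push_cast
  rw [Finset.mul_sum]
  apply Finset.sum_congr rfl
  rintro ⟨x, y⟩ hq
  simp only [hP, Finset.mem_filter, Finset.mem_product, Finset.mem_Icc] at hq
  obtain ⟨⟨⟨hx1, -⟩, ⟨hy1, -⟩⟩, hxy⟩ := hq
  obtain ⟨hx, hy⟩ := odd_of_rep h8 hxy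
  have hset : (NS n).filter (fun α => (α.re.natAbs, α.im.natAbs) = (x, y)) =
      {⟨x, y⟩, ⟨x, -y⟩, ⟨-x, y⟩, ⟨-x, -y⟩} := by
    ext α
    simp only [Finset.mem_filter, mem_NS, norm_eq, Finset.mem_insert, Finset.mem_singleton,
      Zsqrtd.ext_iff, Prod.mk.injEq]
    constructor
    · rintro ⟨-, h1, h2⟩; omega
    · intro h
      have h1 : α.re.natAbs = x := by omega
      have h2 : α.im.natAbs = y := by omega
      refine ⟨?_, h1, h2⟩
      rw [← h1, ← h2] at hxy
      zify at hxy
      rw [sq_abs, sq_abs] at hxy; exact hxy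
  have h4 := four_sum x y hx hy
  push_cast at h4
  rw [hset, Finset.sum_insert, Finset.sum_insert, Finset.sum_pair, ← h4]
  · ring
  all_goals
    simp only [Finset.mem_insert, Finset.mem_singleton, Zsqrtd.ext_iff, ne_eq]
    omega

theorem inert_even {p : ℕ} (hp : p.Prime) (h : p % 8 = 5 ∨ p % 8 = 7) (n : ℕ) :
    0 < n → (∃ x y : ℤ, x ^ 2 + 2 * y ^ 2 = n) → Even (padicValNat p n) := by
  have : Fact p.Prime := ⟨hp⟩
  have hp0 : (p : ℤ) ≠ 0 := by exact_mod_cast hp.ne_zero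
  induction n using Nat.strong_induction_on with
  | _ n ih =>
    rintro hn ⟨x, y, hxy⟩
    by_cases hd : p ∣ n
    · obtain ⟨⟨a, rfl⟩, ⟨b, rfl⟩⟩ := inert_dvd hp h x y (by rw [hxy]; exact_mod_cast hd)
      have h1 : (n : ℤ) = p ^ 2 * (a ^ 2 + 2 * b ^ 2) := by rw [← hxy]; ring
      obtain ⟨m, hm⟩ : ∃ m : ℕ, a ^ 2 + 2 * b ^ 2 = (m : ℤ) :=
        ⟨(a ^ 2 + 2 * b ^ 2).toNat, (Int.toNat_of_nonneg (by positivity)).symm⟩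
      rw [hm] at h1
      have h2 : n = p ^ 2 * m := by exact_mod_cast h1
      have hm0 : 0 < m := by
        rcases Nat.eq_zero_or_pos m with h0 | h0
        · rw [h0] at h2; omega
        · exact h0
      have hlt : m < n := by
        rw [h2]
        exact (lt_mul_iff_one_lt_left hm0).mpr (Nat.one_lt_pow two_ne_zero hp.one_lt)
      rw [h2, padicValNat.mul (pow_ne_zero _ hp.ne_zero) hm0.ne', padicValNat.pow, Nat.even_add]
      exact ⟨fun _ => ih m hlt hm0 ⟨a, b, hm⟩, fun _ => even_two_mul _⟩
    · rw [padicValNat.eq_zero_of_not_dvd hd]; exact Even.zero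

theorem g5_coeff_vanishing (n : ℕ) (hn : 0 < n) (h8 : n % 8 = 3) :
    ∑ p ∈ (Finset.Icc 1 n ×ˢ Finset.Icc 1 n).filter (fun p => p.1 ^ 2 + 2 * p.2 ^ 2 = n), χ₈ p.1 * χm4 p.2 * p.2 = 0 ↔
    ∃ p : ℕ, p.Prime ∧ (p % 8 = 5 ∨ p % 8 = 7) ∧ Odd (padicValNat p n) := by
  constructor
  · intro h
    by_contra hne
    push Not at hne
    refine TT_ne n (by omega) (fun p hp hp8 => ?_) ?_
    · have := hne p hp hp8
      exact Nat.not_odd_iff_even.mp this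
    · rw [TT_eq n h8, h]; simp
  · rintro ⟨p, hp, hp8, hodd⟩
    apply Finset.sum_eq_zero
    rintro ⟨x, y⟩ hq
    exfalso
    simp only [Finset.mem_filter] at hq
    have := inert_even hp hp8 n hn ⟨x, y, by exact_mod_cast hq.2⟩
    exact (Nat.not_even_iff_odd.mpr hodd) this
end
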